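/- Let x, y, z be complex numbers with |x| < 1/2, |y| < 1/4, x ≠ 0, y ≠ 0 and |z²| < |xy|. Set u(t) = 1 − (xy − z²) Φ₀(x,y,z;t). Then u is the unique function holomorphic in a neighborhood of t = 0 with u(0) = 1 which satisfies the Heun-type equation t(1−t²) u″ + ( (1−x)(1−t²) − 2ty ) u′ + 2(xy − z²) u = 0. -/

import Mathlib

open Complex Filter Metric Finset

attribute [local instance] Classical.propDecidable

noncomputable section

/-- Condition on the summation variables of the level-two multiple polylogarithm:
`m` is strictly increasing, `m i ≡ i+1 (mod 2)` (so `m 0` is odd, `m 1` even, ...),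
and all `m i` are positive. -/
def athCond (n : ℕ) (m : Fin n → ℕ) : Prop :=
  StrictMono m ∧ ∀ i : Fin n, m i % 2 = ((i : ℕ) + 1) % 2 ∧ 0 < m i

/-- The last entry `m n` of the summation sequence (junk value `0` for depth `0`). -/
def lastExp {n : ℕ} (m : Fin n → ℕ) : ℕ :=
  if h : 0 < n then m ⟨n - 1, Nat.sub_lt h Nat.one_pos⟩ else 0

/-- The level-two multiple polylogarithm
`Ath(𝐤; t) = Σ_{0<m₁<⋯<mₙ, mᵢ ≡ i (2)} t^{mₙ}/(m₁^{k₁}⋯mₙ^{kₙ})`, with `Ath(∅;t) = 1`. -/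
def Ath {n : ℕ} (k : Fin n → ℕ) (t : ℂ) : ℂ :=
  ∑' m : Fin n → ℕ,
    if athCond n m then t ^ lastExp m / ∏ i, ((m i : ℂ) ^ k i) else 0

/-- The multiple T-value `T(𝐤) = 2^n Σ_{0<m₁<⋯<mₙ, mᵢ ≡ i (2)} 1/(m₁^{k₁}⋯mₙ^{kₙ})`. -/
def Tval {n : ℕ} (k : Fin n → ℕ) : ℝ :=
  2 ^ n * ∑' m : Fin n → ℕ,
    if athCond n m then (∏ i, ((m i : ℝ) ^ k i))⁻¹ else 0

/-- `κ` is an index of weight `k`, depth `n` and height `s`. -/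
def IdxCond (k n s : ℕ) (κ : Fin n → ℕ) : Prop :=
  (∀ i, 1 ≤ κ i) ∧ (∑ i, κ i) = k ∧ (Finset.univ.filter fun i => 2 ≤ κ i).card = s

/-- `κ` is an admissible index of weight `k`, depth `n` and height `s`. -/
def IdxCond0 (k n s : ℕ) (κ : Fin n → ℕ) : Prop :=
  IdxCond k n s κ ∧ ∀ h : 0 < n, 2 ≤ κ ⟨n - 1, Nat.sub_lt h Nat.one_pos⟩

/-- `G(k,n,s;t) = 2^n Σ_{𝐤 ∈ I(k,n,s)} Ath(𝐤;t)`. -/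
def G (k n s : ℕ) (t : ℂ) : ℂ :=
  2 ^ n * ∑' κ : Fin n → ℕ, if IdxCond k n s κ then Ath κ t else 0

/-- `G₀(k,n,s;t) = 2^n Σ_{𝐤 ∈ I₀(k,n,s)} Ath(𝐤;t)`. -/
def G0 (k n s : ℕ) (t : ℂ) : ℂ :=
  2 ^ n * ∑' κ : Fin n → ℕ, if IdxCond0 k n s κ then Ath κ t else 0

/-- `Σ_{𝐤 ∈ I₀(k,n,s)} T(𝐤)`. -/
def sumT0 (k n s : ℕ) : ℝ :=
  ∑' κ : Fin n → ℕ, if IdxCond0 k n s κ then Tval κ else 0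

/-- One term of the generating function `Φ`. -/
def PhiTerm (x y z : ℂ) (p : ℕ × ℕ × ℕ) (t : ℂ) : ℂ :=
  if 1 ≤ p.1 ∧ 1 ≤ p.2.1 then
    G p.1 p.2.1 p.2.2 t * x ^ (p.1 - p.2.1 - p.2.2) * y ^ (p.2.1 - p.2.2) * z ^ (2 * p.2.2)
  else 0

/-- `Φ(x,y,z;t) = 1 + Σ_{k,n≥1, s≥0} G(k,n,s;t) x^{k−n−s} y^{n−s} z^{2s}`. -/
def Phi (x y z t : ℂ) : ℂ := 1 + ∑' p : ℕ × ℕ × ℕ, PhiTerm x y z p t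

/-- One term of the generating function `Φ₀`. -/
def Phi0Term (x y z : ℂ) (p : ℕ × ℕ × ℕ) (t : ℂ) : ℂ :=
  if 1 ≤ p.1 ∧ 1 ≤ p.2.1 ∧ 1 ≤ p.2.2 then
    G0 p.1 p.2.1 p.2.2 t * x ^ (p.1 - p.2.1 - p.2.2) * y ^ (p.2.1 - p.2.2)
      * z ^ (2 * (p.2.2 - 1))
  else 0

/-- `Φ₀(x,y,z;t) = Σ_{k,n,s≥1} G₀(k,n,s;t) x^{k−n−s} y^{n−s} z^{2(s−1)}`. -/
def Phi0 (x y z t : ℂ) : ℂ := ∑' p : ℕ × ℕ × ℕ, Phi0Term x y z p t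

/-- The shifted factorial `(a)ₙ = a(a+1)⋯(a+n−1)`. -/
def poch (a : ℂ) (n : ℕ) : ℂ := ∏ j ∈ Finset.range n, (a + j)

/-- The Gauss hypergeometric series `F(a,b,c;t)`. -/
def hypF (a b c t : ℂ) : ℂ :=
  ∑' n : ℕ, poch a n * poch b n / ((n.factorial : ℂ) * poch c n) * t ^ n

theorem ps_fps (a : ℕ → ℂ) (f : ℂ → ℂ) (r : ℝ) (hr : 0 < r)
    (h : ∀ t ∈ ball (0 : ℂ) r, HasSum (fun j => a j * t ^ j) (f t)) :
    HasFPowerSeriesOnBall f (FormalMultilinearSeries.ofScalars ℂ a) 0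
      (ENNReal.ofReal (r / 2)) := by
  have hr2 : (0 : ℝ) < r / 2 := by linarith
  refine ⟨?_, by simpa using hr2, ?_⟩
  · have := (h (((r / 2 : ℝ)) : ℂ) (by
      simp only [mem_ball_zero_iff, Complex.norm_real, Real.norm_eq_abs, abs_of_pos hr2]
      linarith)).summable.norm
    apply FormalMultilinearSeries.le_radius_of_summable
    refine this.congr fun j => ?_
    rw [FormalMultilinearSeries.ofScalars_norm, norm_mul, norm_pow, Complex.norm_real,
      Real.norm_eq_abs, abs_of_pos hr2]
    simp [hr2.le]
  · intro t ht
    have ht' : t ∈ ball (0 : ℂ) r := by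
      rw [Metric.eball_ofReal] at ht
      exact ball_subset_ball (by linarith) ht
    simpa [FormalMultilinearSeries.ofScalars_apply_eq, mul_comm] using h t ht'

theorem ps_zero (a : ℕ → ℂ) (r : ℝ) (hr : 0 < r)
    (h : ∀ t ∈ ball (0 : ℂ) r, HasSum (fun j => a j * t ^ j) 0) : ∀ j, a j = 0 := by
  have H := ps_fps a 0 r hr h
  have h0 := H.hasFPowerSeriesAt.eq_zero
  intro j
  have := (FormalMultilinearSeries.ofScalars_series_eq_zero (E := ℂ)).1 h0
  exact congrFun this j

def tc (f : ℂ → ℂ) (j : ℕ) : ℂ := ((j.factorial : ℕ) : ℂ)⁻¹ * iteratedDeriv j f 0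

theorem tc_hasSum {f : ℂ → ℂ} {r : ℝ} (hf : DifferentiableOn ℂ f (ball 0 r)) {t : ℂ}
    (ht : t ∈ ball (0 : ℂ) r) : HasSum (fun j => tc f j * t ^ j) (f t) := by
  have := Complex.hasSum_taylorSeries_on_ball hf ht
  refine this.congr_fun ?_ |> fun h => h
  intro j
  simp only [tc, smul_eq_mul, sub_zero]; ring

theorem tc_deriv (f : ℂ → ℂ) (j : ℕ) : tc (deriv f) j = ((j : ℂ) + 1) * tc f (j + 1) := by
  simp only [tc, iteratedDeriv_succ', Nat.factorial_succ, Nat.cast_mul, Nat.cast_succ]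
  have : ((j : ℂ) + 1) ≠ 0 := by exact_mod_cast Nat.succ_ne_zero j
  have : ((j.factorial : ℕ) : ℂ) ≠ 0 := by exact_mod_cast Nat.factorial_ne_zero j
  field_simp

theorem tc_unique {f : ℂ → ℂ} {r : ℝ} (hr : 0 < r) (hf : DifferentiableOn ℂ f (ball 0 r))
    (a : ℕ → ℂ) (h : ∀ t ∈ ball (0 : ℂ) r, HasSum (fun j => a j * t ^ j) (f t)) (j : ℕ) :
    tc f j = a j := by
  have := ps_zero (fun j => tc f j - a j) r hr (fun t ht => by
    have := (tc_hasSum hf ht).sub (h t ht)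
    simpa [sub_mul] using this) j
  exact sub_eq_zero.1 this

def sh (a : ℕ → ℂ) : ℕ → ℂ
  | 0 => 0
  | (j + 1) => a j

theorem sh_hasSum {a : ℕ → ℂ} {t s : ℂ} (h : HasSum (fun j => a j * t ^ j) s) :
    HasSum (fun j => sh a j * t ^ j) (t * s) := by
  rw [← hasSum_nat_add_iff' 1]
  simp only [sh, Finset.sum_range_one, zero_mul, sub_zero]
  have := h.mul_left t
  convert! this using 2
  ring

/-- The recurrence equivalent to the equation. -/
def Rec (x y z : ℂ) (a : ℕ → ℂ) : Prop :=
  (1 - x) * a 1 + 2 * (x * y - z ^ 2) * a 0 = 0 ∧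
  ∀ j : ℕ, ((j : ℂ) + 2) * (j + 2 - x) * a (j + 2) - j * (j - x) * a j
    - 2 * (y * (j + 1) - x * y + z ^ 2) * a (j + 1) = 0

def odeCoef (x y z : ℂ) (a : ℕ → ℂ) : ℕ → ℂ
  | 0 => (1 - x) * a 1 + 2 * (x * y - z ^ 2) * a 0
  | (j + 1) => ((j : ℂ) + 2) * (j + 2 - x) * a (j + 2) - j * (j - x) * a j
    - 2 * (y * (j + 1) - x * y + z ^ 2) * a (j + 1)

theorem ode_hasSum (x y z : ℂ) {f : ℂ → ℂ} {r : ℝ} (hf : DifferentiableOn ℂ f (ball 0 r)) {t : ℂ}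
    (ht : t ∈ ball (0 : ℂ) r) : HasSum (fun j => odeCoef x y z (tc f) j * t ^ j)
      (t * (1 - t ^ 2) * deriv (deriv f) t
            + ((1 - x) * (1 - t ^ 2) - 2 * t * y) * deriv f t
            + 2 * (x * y - z ^ 2) * f t) := by
  have hf1 : DifferentiableOn ℂ (deriv f) (ball 0 r) := hf.deriv isOpen_ball
  have hf2 : DifferentiableOn ℂ (deriv (deriv f)) (ball 0 r) := hf1.deriv isOpen_ball
  have h0 := tc_hasSum hf ht
  have h1 := tc_hasSum hf1 ht
  have h2 := tc_hasSum hf2 ht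
  have A := (((((sh_hasSum h2).sub (sh_hasSum (sh_hasSum (sh_hasSum h2)))).add
    (h1.mul_left (1 - x))).sub ((sh_hasSum (sh_hasSum h1)).mul_left (1 - x))).sub
    ((sh_hasSum h1).mul_left (2 * y))).add (h0.mul_left (2 * (x * y - z ^ 2)))
  convert! A using 1
  · funext j
    rcases j with _ | _ | _ | j <;>
    simp only [odeCoef, sh, tc_deriv] <;> push_cast <;> ring
  · ring

theorem ode_iff_rec (x y z : ℂ) {f : ℂ → ℂ} {r : ℝ} (hr : 0 < r)
    (hf : DifferentiableOn ℂ f (ball 0 r)) :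
    (∀ t ∈ ball (0 : ℂ) r, t * (1 - t ^ 2) * deriv (deriv f) t
            + ((1 - x) * (1 - t ^ 2) - 2 * t * y) * deriv f t
            + 2 * (x * y - z ^ 2) * f t = 0) ↔ Rec x y z (tc f) := by
  constructor
  · intro h
    have := ps_zero (odeCoef x y z (tc f)) r hr (fun t ht => by
      have A := ode_hasSum x y z hf ht
      rwa [h t ht] at A)
    exact ⟨this 0, fun j => this (j + 1)⟩
  · intro h t ht
    have A := ode_hasSum x y z hf ht
    have : (fun j => odeCoef x y z (tc f) j * t ^ j) = fun _ => 0 := by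
      funext j
      rcases j with _ | j
      · simp only [odeCoef, h.1, zero_mul]
      · simp only [odeCoef, h.2 j, zero_mul]
    rw [this] at A
    exact A.unique hasSum_zero

theorem sub_ne (x : ℂ) (hx : ‖x‖ < 1 / 2) (j : ℕ) (hj : 1 ≤ j) : (j : ℂ) - x ≠ 0 := by
  intro h
  have h1 : (j : ℂ) = x := sub_eq_zero.1 h
  rw [← h1, Complex.norm_natCast] at hx
  have : (1 : ℝ) ≤ j := by exact_mod_cast hj
  linarith

theorem rec_unique (x y z : ℂ) (hx : ‖x‖ < 1 / 2) (a b : ℕ → ℂ) (ha : Rec x y z a)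
    (hb : Rec x y z b) (h0 : a 0 = b 0) : ∀ j, a j = b j := by
  have key : ∀ j, a j = b j ∧ a (j + 1) = b (j + 1) := by
    intro j
    induction j with
    | zero =>
      refine ⟨h0, ?_⟩
      have h1 : (1 : ℂ) - x ≠ 0 := by simpa using sub_ne x hx 1 le_rfl
      apply mul_left_cancel₀ h1
      have e1 := ha.1
      have e2 := hb.1
      rw [h0] at e1
      simp only [zero_add]
      linear_combination e1 - e2
    | succ j ih =>
      refine ⟨ih.2, ?_⟩
      have h1 : ((j : ℂ) + 2 - x) ≠ 0 := by
        have := sub_ne x hx (j + 2) (by omega)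
        push_cast at this
        exact this
      have h2 : ((j : ℂ) + 2) ≠ 0 := by exact_mod_cast (by omega : j + 2 ≠ 0)
      apply mul_left_cancel₀ (mul_ne_zero h2 h1)
      have e1 := ha.2 j
      have e2 := hb.2 j
      rw [ih.1, ih.2] at e1
      show _ * a (j + 2) = _ * b (j + 2)
      linear_combination e1 - e2
  exact fun j => (key j).1

theorem step_sum {β : Type*} (H : ℕ → ℕ → ℂ) (v : ℕ → β → ℂ)
    (hH : ∀ j, Summable fun k => ‖H j k‖) (hv : ∀ j, Summable fun b => ‖v j b‖)
    (hs : Summable fun j => (∑' k, ‖H j k‖) * ∑' b, ‖v j b‖) :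
    Summable (fun p : ℕ × ℕ × β => ‖H p.1 p.2.1 * v p.1 p.2.2‖) ∧
    (∑' p : ℕ × ℕ × β, ‖H p.1 p.2.1 * v p.1 p.2.2‖ = ∑' j, (∑' k, ‖H j k‖) * ∑' b, ‖v j b‖) ∧
    (∑' p : ℕ × ℕ × β, H p.1 p.2.1 * v p.1 p.2.2 = ∑' j, (∑' k, H j k) * ∑' b, v j b) := by
  have h1 : ∀ j, Summable fun q : ℕ × β => ‖H j q.1 * v j q.2‖ := fun j =>
    (hH j).mul_norm (hv j)
  have h2 : ∀ j, ∑' q : ℕ × β, ‖H j q.1 * v j q.2‖ = (∑' k, ‖H j k‖) * ∑' b, ‖v j b‖ := by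
    intro j
    simp only [norm_mul]
    have h3 := h1 j
    simp only [norm_mul] at h3
    exact ((hH j).tsum_mul_tsum (hv j) h3).symm
  have h3 : Summable (fun p : ℕ × ℕ × β => ‖H p.1 p.2.1 * v p.1 p.2.2‖) := by
    rw [summable_prod_of_nonneg (fun _ => norm_nonneg _)]
    refine ⟨h1, ?_⟩
    simp only [h2]
    exact hs
  refine ⟨h3, ?_, ?_⟩
  · rw [h3.tsum_prod]
    simp only [h2]
  · rw [h3.of_norm.tsum_prod]
    congr 1
    funext j
    exact (tsum_mul_tsum_of_summable_norm (hH j) (hv j)).symm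

def gg (x y z : ℂ) (j k : ℕ) : ℂ :=
  2 * (if k = 0 then 0 else if k = 1 then y else x ^ (k - 2) * z ^ 2) / (j : ℂ) ^ k

def hh (x : ℂ) (j k : ℕ) : ℂ :=
  if 2 ≤ k then 2 * x ^ (k - 2) / (j : ℂ) ^ k else 0

def ww (x y z : ℂ) (j : ℕ) : ℂ := 2 * (y / j + z ^ 2 / (j * (j - x)))

theorem geom_aux (x : ℂ) (hx : ‖x‖ < 1 / 2) (j : ℕ) :
    (Summable fun k : ℕ => ‖x ^ k / (j : ℂ) ^ (k + 2)‖) ∧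
    (∑' k : ℕ, ‖x ^ k / (j : ℂ) ^ (k + 2)‖ ≤ 2) ∧
    (∑' k : ℕ, x ^ k / (j : ℂ) ^ (k + 2) = 1 / (j * (j - x))) := by
  rcases Nat.eq_zero_or_pos j with rfl | hj
  · simp [summable_zero]
  have hj1 : (1 : ℝ) ≤ j := by exact_mod_cast hj
  have hj0 : (j : ℂ) ≠ 0 := by exact_mod_cast hj.ne'
  have hb : ∀ k : ℕ, ‖x ^ k / (j : ℂ) ^ (k + 2)‖ ≤ (1 / 2 : ℝ) ^ k := by
    intro k
    rw [norm_div, norm_pow, norm_pow, Complex.norm_natCast]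
    have h1 : (1 : ℝ) ≤ (j : ℝ) ^ (k + 2) := one_le_pow₀ hj1
    calc ‖x‖ ^ k / (j : ℝ) ^ (k + 2) ≤ ‖x‖ ^ k / 1 := by gcongr
      _ ≤ (1 / 2 : ℝ) ^ k := by rw [div_one]; gcongr
  have hs : Summable fun k : ℕ => ‖x ^ k / (j : ℂ) ^ (k + 2)‖ :=
    Summable.of_nonneg_of_le (fun _ => norm_nonneg _) hb summable_geometric_two
  refine ⟨hs, ?_, ?_⟩
  · calc _ ≤ ∑' k : ℕ, (1 / 2 : ℝ) ^ k := hs.tsum_le_tsum hb summable_geometric_two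
      _ = 2 := tsum_geometric_two
  · have hlt : ‖x / j‖ < 1 := by
      rw [norm_div, Complex.norm_natCast, div_lt_one (by linarith)]
      linarith
    have := (hasSum_geometric_of_norm_lt_one hlt).mul_left (1 / (j : ℂ) ^ 2)
    have hjx := sub_ne x hx j hj
    have e : (fun k : ℕ => x ^ k / (j : ℂ) ^ (k + 2)) =
        fun k : ℕ => 1 / (j : ℂ) ^ 2 * (x / j) ^ k := by
      funext k
      rw [div_pow, pow_add]; field_simp
    rw [e, this.tsum_eq]
    have : 1 - x / j ≠ 0 := by
      intro h
      apply hjx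
      field_simp at h
      simpa using h
    field_simp

theorem gg_aux (x y z : ℂ) (hx : ‖x‖ < 1 / 2) (hy : ‖y‖ < 1 / 4) (hz : ‖z ^ 2‖ < ‖x * y‖) (j : ℕ) :
    (Summable fun k => ‖gg x y z j k‖) ∧ (∑' k, ‖gg x y z j k‖ ≤ 1) ∧
    ∑' k, gg x y z j k = ww x y z j := by
  obtain ⟨h1, h2, h3⟩ := geom_aux x hx j
  have hz' : ‖z ^ 2‖ ≤ 1 / 8 := by
    rw [norm_mul] at hz
    nlinarith [norm_nonneg x, norm_nonneg y]
  have e : ∀ k, gg x y z j (k + 2) = (2 * z ^ 2) * (x ^ k / (j : ℂ) ^ (k + 2)) := by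
    intro k
    simp only [gg]
    rw [if_neg (by omega), if_neg (by omega), Nat.add_sub_cancel]; ring
  have hs2 : Summable fun k => ‖gg x y z j (k + 2)‖ := by
    simp only [e, norm_mul (2 * z ^ 2)]
    exact h1.mul_left _
  have hs : Summable fun k => ‖gg x y z j k‖ := (summable_nat_add_iff 2).1 hs2
  have g0 : gg x y z j 0 = 0 := by simp [gg]
  have g1 : gg x y z j 1 = 2 * (y / j) := by simp [gg]; ring
  refine ⟨hs, ?_, ?_⟩
  · rw [← hs.sum_add_tsum_nat_add 2]
    simp only [Finset.sum_range_succ, Finset.sum_range_zero, g0, g1, e, norm_mul (2 * z ^ 2)]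
    rw [tsum_mul_left]
    have : ‖2 * (y / (j : ℂ))‖ ≤ 1 / 2 := by
      rcases Nat.eq_zero_or_pos j with rfl | hj
      · simp
      have hj1 : (1 : ℝ) ≤ j := by exact_mod_cast hj
      rw [norm_mul, norm_div, Complex.norm_natCast, Complex.norm_ofNat]
      have : ‖y‖ / j ≤ ‖y‖ / 1 := by gcongr
      rw [div_one] at this
      linarith
    have h4 : ‖2 * z ^ 2‖ ≤ 1 / 4 := by rw [norm_mul, Complex.norm_ofNat]; linarith
    have h5 : ‖2 * z ^ 2‖ * ∑' k : ℕ, ‖x ^ k / (j : ℂ) ^ (k + 2)‖ ≤ 1 / 4 * 2 := by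
      gcongr
    simp only [norm_zero]
    linarith
  · rw [← hs.of_norm.sum_add_tsum_nat_add 2]
    simp only [Finset.sum_range_succ, Finset.sum_range_zero, g0, g1, e]
    rw [tsum_mul_left, h3, ww]
    ring

theorem hh_aux (x : ℂ) (hx : ‖x‖ < 1 / 2) (j : ℕ) :
    (Summable fun k => ‖hh x j k‖) ∧ (∑' k, ‖hh x j k‖ ≤ 4) ∧
    ∑' k, hh x j k = 2 / (j * (j - x)) := by
  obtain ⟨h1, h2, h3⟩ := geom_aux x hx j
  have e : ∀ k, hh x j (k + 2) = 2 * (x ^ k / (j : ℂ) ^ (k + 2)) := by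
    intro k
    simp only [hh]
    rw [if_pos (by omega), Nat.add_sub_cancel]; ring
  have hs2 : Summable fun k => ‖hh x j (k + 2)‖ := by
    simp only [e, norm_mul (2 : ℂ)]
    exact h1.mul_left _
  have hs : Summable fun k => ‖hh x j k‖ := (summable_nat_add_iff 2).1 hs2
  have g0 : hh x j 0 = 0 := by simp [hh]
  have g1 : hh x j 1 = 0 := by simp [hh]
  refine ⟨hs, ?_, ?_⟩
  · rw [← hs.sum_add_tsum_nat_add 2]
    simp only [Finset.sum_range_succ, Finset.sum_range_zero, g0, g1, e, norm_mul (2 : ℂ)]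
    rw [tsum_mul_left, Complex.norm_ofNat]
    simp only [norm_zero]
    linarith
  · rw [← hs.of_norm.sum_add_tsum_nat_add 2]
    simp only [Finset.sum_range_succ, Finset.sum_range_zero, g0, g1, e]
    rw [tsum_mul_left, h3]
    ring

/-- Pairs (index, summation variables). -/
abbrev BB (n : ℕ) : Type := (Fin n → ℕ) × (Fin n → ℕ)

def ee (n : ℕ) : BB (n + 1) ≃ ℕ × ℕ × BB n where
  toFun b := (b.2 (Fin.last n), b.1 (Fin.last n), (fun i => b.1 i.castSucc, fun i => b.2 i.castSucc))
  invFun p := (Fin.snoc (α := fun _ => ℕ) p.2.2.1 p.2.1, Fin.snoc (α := fun _ => ℕ) p.2.2.2 p.1)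
  left_inv b := by
    ext i
    · refine Fin.lastCases ?_ (fun i => ?_) i <;> simp
    · refine Fin.lastCases ?_ (fun i => ?_) i <;> simp
  right_inv p := by simp

theorem athCond_succ (n : ℕ) (m : Fin (n + 1) → ℕ) :
    athCond (n + 1) m ↔ (athCond n (fun i => m i.castSucc) ∧ ∀ i : Fin n, m i.castSucc < m (Fin.last n))
      ∧ m (Fin.last n) % 2 = (n + 1) % 2 ∧ 0 < m (Fin.last n) := by
  constructor
  · rintro ⟨h1, h2⟩
    refine ⟨⟨⟨fun i j hij => h1 (by simpa using hij), fun i => h2 i.castSucc⟩, fun i => h1 (Fin.castSucc_lt_last i)⟩,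
      h2 (Fin.last n)⟩
  · rintro ⟨⟨⟨h1, h2⟩, h3⟩, h4⟩
    refine ⟨?_, ?_⟩
    · intro i j
      refine Fin.lastCases ?_ (fun i => ?_) i <;> refine Fin.lastCases ?_ (fun j => ?_) j
      · simp
      · intro h
        exact absurd h (not_lt.2 (Fin.le_last _))
      · intro _; exact h3 i
      · intro h
        exact h1 (by simpa using h)
    · intro i
      refine Fin.lastCases ?_ (fun i => ?_) i
      · exact h4
      · exact h2 i

def VV (x y z : ℂ) (n M : ℕ) (b : BB n) : ℂ :=
  if athCond n b.2 ∧ ∀ i, b.2 i < M then ∏ i, gg x y z (b.2 i) (b.1 i) else 0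

def gc (x y z : ℂ) (n M j k : ℕ) : ℂ :=
  if j < M ∧ j % 2 = (n + 1) % 2 ∧ 0 < j then gg x y z j k else 0

theorem VV_succ (x y z : ℂ) (n M : ℕ) (b : BB (n + 1)) :
    VV x y z (n + 1) M b =
      gc x y z n M (ee n b).1 (ee n b).2.1 * VV x y z n (ee n b).1 (ee n b).2.2 := by
  have hc : (athCond (n + 1) b.2 ∧ ∀ i, b.2 i < M) ↔
      (b.2 (Fin.last n) < M ∧ b.2 (Fin.last n) % 2 = (n + 1) % 2 ∧ 0 < b.2 (Fin.last n)) ∧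
      (athCond n (fun i => b.2 i.castSucc) ∧ ∀ i : Fin n, b.2 i.castSucc < b.2 (Fin.last n)) := by
    rw [athCond_succ]
    constructor
    · rintro ⟨⟨h1, h2⟩, h3⟩
      exact ⟨⟨h3 _, h2⟩, h1⟩
    · rintro ⟨⟨h1, h2⟩, h3⟩
      refine ⟨⟨h3, h2⟩, fun i => ?_⟩
      refine Fin.lastCases h1 (fun i => (h3.2 i).trans h1) i
  have hee : ee n b = (b.2 (Fin.last n), b.1 (Fin.last n),
    ((fun i => b.1 i.castSucc), (fun i => b.2 i.castSucc))) := rfl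
  rw [hee]
  simp only [VV, gc]
  rw [if_congr hc rfl rfl, Fin.prod_univ_castSucc]
  by_cases h1 : (b.2 (Fin.last n) < M ∧ b.2 (Fin.last n) % 2 = (n + 1) % 2 ∧ 0 < b.2 (Fin.last n))
  · by_cases h2 : (athCond n (fun i => b.2 i.castSucc) ∧ ∀ i : Fin n, b.2 i.castSucc < b.2 (Fin.last n))
    · rw [if_pos ⟨h1, h2⟩, if_pos h1, if_pos h2, mul_comm]
    · rw [if_neg (fun h => h2 h.2), if_neg h2, mul_zero]
  · rw [if_neg (fun h => h1 h.1), if_neg h1, zero_mul]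

def SS (x y z : ℂ) (n M : ℕ) : ℂ := ∑' b, VV x y z n M b

theorem gc_aux (x y z : ℂ) (hx : ‖x‖ < 1 / 2) (hy : ‖y‖ < 1 / 4) (hz : ‖z ^ 2‖ < ‖x * y‖)
    (n M j : ℕ) :
    (Summable fun k => ‖gc x y z n M j k‖) ∧ (∑' k, ‖gc x y z n M j k‖ ≤ if j < M then 1 else 0) ∧
    ∑' k, gc x y z n M j k = if j < M ∧ j % 2 = (n + 1) % 2 ∧ 0 < j then ww x y z j else 0 := by
  obtain ⟨h1, h2, h3⟩ := gg_aux x y z hx hy hz j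
  by_cases h : j < M ∧ j % 2 = (n + 1) % 2 ∧ 0 < j
  · simp only [gc, if_pos h, if_pos h.1]
    exact ⟨h1, h2, h3⟩
  · simp only [gc, if_neg h]
    refine ⟨by simp, ?_, by simp⟩
    simp only [norm_zero, tsum_zero]
    split_ifs <;> norm_num

theorem geom3 (M : ℕ) : ∑ j ∈ Finset.range M, (3 : ℝ) ^ j ≤ 1 / 2 * 3 ^ M := by
  induction M with
  | zero => simp
  | succ M ih => rw [Finset.sum_range_succ, pow_succ]; linarith

theorem VV_aux (x y z : ℂ) (hx : ‖x‖ < 1 / 2) (hy : ‖y‖ < 1 / 4) (hz : ‖z ^ 2‖ < ‖x * y‖)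
    (n : ℕ) : ∀ M : ℕ,
    (Summable fun b => ‖VV x y z n M b‖) ∧ (∑' b, ‖VV x y z n M b‖ ≤ (1 / 2 : ℝ) ^ n * 3 ^ M) := by
  induction n with
  | zero =>
    intro M
    have : ∀ b : BB 0, VV x y z 0 M b = 1 := by
      intro b
      have : athCond 0 b.2 := ⟨fun i => i.elim0, fun i => i.elim0⟩
      simp [VV, this]
    simp only [this]
    refine ⟨(hasSum_fintype _).summable, ?_⟩
    simp only [norm_one, tsum_fintype]
    simpa using one_le_pow₀ (by norm_num : (1 : ℝ) ≤ 3)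
  | succ n ih =>
    intro M
    have hle : ∀ j, (∑' k, ‖gc x y z n M j k‖) * ∑' b, ‖VV x y z n j b‖ ≤
        if j ∈ Finset.range M then (1 / 2 : ℝ) ^ n * 3 ^ j else 0 := by
      intro j
      have h1 := (gc_aux x y z hx hy hz n M j).2.1
      have h2 := (ih j).2
      have h3 : 0 ≤ ∑' b, ‖VV x y z n j b‖ := tsum_nonneg fun _ => norm_nonneg _
      simp only [Finset.mem_range]
      split_ifs at h1 ⊢ with hj
      · calc _ ≤ 1 * ∑' b, ‖VV x y z n j b‖ := by gcongr
          _ ≤ _ := by rw [one_mul]; exact h2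
      · exact mul_nonpos_of_nonpos_of_nonneg h1 h3
    have hfs : Summable fun j => if j ∈ Finset.range M then (1 / 2 : ℝ) ^ n * 3 ^ j else 0 :=
      summable_of_ne_finset_zero (s := Finset.range M) (fun j hj => if_neg hj)
    have hs : Summable fun j => (∑' k, ‖gc x y z n M j k‖) * ∑' b, ‖VV x y z n j b‖ :=
      Summable.of_nonneg_of_le (fun j => mul_nonneg (tsum_nonneg fun _ => norm_nonneg _)
        (tsum_nonneg fun _ => norm_nonneg _)) hle hfs
    obtain ⟨a1, a2, a3⟩ := step_sum (gc x y z n M) (fun j b => VV x y z n j b)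
      (fun j => (gc_aux x y z hx hy hz n M j).1) (fun j => (ih j).1) hs
    simp only [VV_succ]
    constructor
    · exact (ee n).summable_iff.2 a1
    · rw [(ee n).tsum_eq (fun p => ‖gc x y z n M p.1 p.2.1 * VV x y z n p.1 p.2.2‖), a2]
      refine (hs.tsum_le_tsum hle hfs).trans ?_
      rw [tsum_eq_sum (s := Finset.range M) (fun j hj => if_neg hj)]
      rw [Finset.sum_ite_mem, Finset.inter_self, ← Finset.mul_sum, pow_succ, mul_assoc]
      gcongr
      exact geom3 M

theorem SS_zero (x y z : ℂ) (M : ℕ) : SS x y z 0 M = 1 := by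
  have : ∀ b : BB 0, VV x y z 0 M b = 1 := by
    intro b
    have : athCond 0 b.2 := ⟨fun i => i.elim0, fun i => i.elim0⟩
    simp [VV, this]
  simp [SS, this]

theorem SS_succ (x y z : ℂ) (hx : ‖x‖ < 1 / 2) (hy : ‖y‖ < 1 / 4) (hz : ‖z ^ 2‖ < ‖x * y‖)
    (n M : ℕ) : SS x y z (n + 1) M = ∑ j ∈ Finset.range M,
      if j % 2 = (n + 1) % 2 then ww x y z j * SS x y z n j else 0 := by
  have hs : Summable fun j => (∑' k, ‖gc x y z n M j k‖) * ∑' b, ‖VV x y z n j b‖ := by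
    refine summable_of_ne_finset_zero (s := Finset.range M) (fun j hj => ?_)
    have : ∀ k, gc x y z n M j k = 0 := fun k => if_neg (fun h => hj (Finset.mem_range.2 h.1))
    simp [this]
  obtain ⟨a1, a2, a3⟩ := step_sum (gc x y z n M) (fun j b => VV x y z n j b)
      (fun j => (gc_aux x y z hx hy hz n M j).1) (fun j => (VV_aux x y z hx hy hz n j).1) hs
  rw [SS]
  simp only [VV_succ]
  rw [(ee n).tsum_eq (fun p => gc x y z n M p.1 p.2.1 * VV x y z n p.1 p.2.2), a3]
  simp only [(gc_aux x y z hx hy hz n M _).2.2]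
  rw [tsum_eq_sum (s := Finset.range M) (fun j hj => by
    rw [if_neg (fun h => hj (Finset.mem_range.2 h.1)), zero_mul])]
  refine Finset.sum_congr rfl fun j hj => ?_
  have hj' := Finset.mem_range.1 hj
  rcases Nat.eq_zero_or_pos j with rfl | hj0
  · simp [ww]
  · simp [hj', hj0, SS]

def htt {n : ℕ} (κ : Fin n → ℕ) : ℕ := (Finset.univ.filter fun i => 2 ≤ κ i).card

theorem htt_succ {n : ℕ} (κ : Fin (n + 1) → ℕ) :
    htt κ = htt (fun i : Fin n => κ i.castSucc) + if 2 ≤ κ (Fin.last n) then 1 else 0 := by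
  simp only [htt, Finset.card_filter]
  rw [Fin.sum_univ_castSucc]

theorem mono_aux (x y z : ℂ) (n : ℕ) : ∀ (κ : Fin n → ℕ), (∀ i, 1 ≤ κ i) →
    ∃ a c : ℕ, ∑ i, κ i = n + htt κ + a ∧ n = htt κ + c ∧
      ∏ i, (if κ i = 0 then 0 else if κ i = 1 then y else x ^ (κ i - 2) * z ^ 2)
        = x ^ a * y ^ c * z ^ (2 * htt κ) := by
  induction n with
  | zero =>
    intro κ _
    refine ⟨0, 0, ?_, ?_, ?_⟩ <;> simp [htt]
  | succ n ih =>
    intro κ hκ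
    obtain ⟨a, c, h1, h2, h3⟩ := ih (fun i => κ i.castSucc) (fun i => hκ _)
    rw [Fin.sum_univ_castSucc, Fin.prod_univ_castSucc, h3, h1, htt_succ]
    have hl := hκ (Fin.last n)
    by_cases hk : 2 ≤ κ (Fin.last n)
    · refine ⟨a + (κ (Fin.last n) - 2), c, ?_, ?_, ?_⟩
      · rw [if_pos hk]; omega
      · rw [if_pos hk]; omega
      · rw [if_pos hk, if_neg (by omega), if_neg (by omega)]
        ring
    · refine ⟨a, c + 1, ?_, ?_, ?_⟩
      · rw [if_neg hk]; omega
      · rw [if_neg hk]; omega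
      · rw [if_neg hk, if_neg (by omega), if_pos (by omega)]
        ring

def FF (x y z t : ℂ) (n : ℕ) (b : BB n) : ℂ :=
  if athCond n b.2 ∧ IdxCond0 (∑ i, b.1 i) n (htt b.1) b.1 ∧ 0 < n then
    2 ^ n * (t ^ lastExp b.2 / ∏ i, ((b.2 i : ℂ) ^ b.1 i)) * x ^ (∑ i, b.1 i - n - htt b.1)
      * y ^ (n - htt b.1) * z ^ (2 * (htt b.1 - 1))
  else 0

def hc (x t : ℂ) (n j k : ℕ) : ℂ :=
  if j % 2 = (n + 1) % 2 ∧ 0 < j then t ^ j * hh x j k else 0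

theorem FF_succ (x y z t : ℂ) (n : ℕ) (b : BB (n + 1)) :
    FF x y z t (n + 1) b =
      hc x t n (ee n b).1 (ee n b).2.1 * VV x y z n (ee n b).1 (ee n b).2.2 := by
  obtain ⟨κ, m⟩ := b
  have hee : ee n (κ, m) = (m (Fin.last n), κ (Fin.last n),
    ((fun i => κ i.castSucc), (fun i => m i.castSucc))) := rfl
  rw [hee]
  simp only [VV, hc, FF]
  have hath := athCond_succ n m
  by_cases h1 : m (Fin.last n) % 2 = (n + 1) % 2 ∧ 0 < m (Fin.last n)
  swap
  · rw [if_neg h1, zero_mul, if_neg (fun h => h1 (hath.1 h.1).2)]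
  by_cases h2 : (athCond n (fun i => m i.castSucc) ∧ ∀ i : Fin n, m i.castSucc < m (Fin.last n))
  swap
  · rw [if_neg h2, mul_zero, if_neg (fun h => h2 (hath.1 h.1).1)]
  rw [if_pos h1, if_pos h2]
  have h12 := hath.2 ⟨h2, h1⟩
  by_cases h3 : 2 ≤ κ (Fin.last n)
  swap
  · rw [hh, if_neg h3, mul_zero, zero_mul, if_neg]
    intro h
    exact h3 (h.2.1.2 (Nat.succ_pos n))
  by_cases h4 : ∀ i : Fin n, 1 ≤ κ i.castSucc
  swap
  · push Not at h4
    obtain ⟨i, hi⟩ := h4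
    have h0 : κ i.castSucc = 0 := by omega
    rw [Finset.prod_eq_zero (Finset.mem_univ i) (by simp [gg, h0]), mul_zero, if_neg]
    intro h
    have := h.2.1.1.1 i.castSucc
    omega
  have h5 : ∀ i, 1 ≤ κ i := fun i => Fin.lastCases (by omega) h4 i
  rw [if_pos ⟨h12, ⟨⟨h5, rfl, rfl⟩, fun _ => h3⟩, Nat.succ_pos n⟩]
  obtain ⟨a, c, e1, e2, e3⟩ := mono_aux x y z n (fun i => κ i.castSucc) h4
  rw [hh, if_pos h3]
  simp only [gg]
  rw [Finset.prod_div_distrib, Finset.prod_mul_distrib, Finset.prod_const, e3, htt_succ, if_pos h3,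
    Fin.sum_univ_castSucc, e1, Fin.prod_univ_castSucc]
  have a1 : n + htt (fun i : Fin n => κ i.castSucc) + a + κ (Fin.last n) - (n + 1)
    - (htt (fun i : Fin n => κ i.castSucc) + 1) = a + (κ (Fin.last n) - 2) := by omega
  have a2 : n + 1 - (htt (fun i : Fin n => κ i.castSucc) + 1) = c := by omega
  have a3 : lastExp m = m (Fin.last n) := by
    simp only [lastExp, Nat.succ_pos, dif_pos]
    rfl
  rw [a1, a2, a3, Nat.add_sub_cancel, Finset.card_univ, Fintype.card_fin, pow_add, pow_succ]
  simp only [div_eq_mul_inv, mul_inv]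
  ring

theorem Phi0Term_eq (x y z t : ℂ) (p : ℕ × ℕ × ℕ) :
    Phi0Term x y z p t = ∑' κ : Fin p.2.1 → ℕ, ∑' m : Fin p.2.1 → ℕ,
      if ∑ i, κ i = p.1 ∧ htt κ = p.2.2 then FF x y z t p.2.1 (κ, m) else 0 := by
  obtain ⟨k, n, s⟩ := p
  simp only [Phi0Term]
  by_cases h : 1 ≤ k ∧ 1 ≤ n ∧ 1 ≤ s
  · rw [if_pos h, G0]
    rw [← tsum_mul_left, ← tsum_mul_right, ← tsum_mul_right, ← tsum_mul_right]
    congr 1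
    funext κ
    by_cases hI : IdxCond0 k n s κ
    · rw [if_pos hI, Ath, ← tsum_mul_left, ← tsum_mul_right, ← tsum_mul_right, ← tsum_mul_right]
      congr 1
      funext m
      obtain ⟨⟨b1, b2, b3⟩, b4⟩ := id hI
      have b3' : htt κ = s := b3
      rw [FF]
      simp only [b2, b3', and_self, if_true]
      by_cases ha : athCond n m
      · rw [if_pos ha, if_pos ⟨ha, hI, h.2.1⟩]
      · rw [if_neg ha, if_neg (fun h => ha h.1)]
        simp
    · rw [if_neg hI]
      simp only [mul_zero, zero_mul]
      symm
      convert tsum_zero with m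
      split_ifs with hs
      · rw [FF, if_neg]
        rintro ⟨_, h2, _⟩
        simp only [hs.1, hs.2] at h2
        exact hI h2
      · rfl
  · rw [if_neg h]
    symm
    convert tsum_zero with κ
    convert tsum_zero with m
    split_ifs with hs
    · rw [FF, if_neg]
      rintro ⟨_, h2, h3⟩
      apply h
      have hl := h2.2 h3
      have hh1 : κ ⟨n - 1, Nat.sub_lt h3 Nat.one_pos⟩ ≤ ∑ i, κ i :=
        Finset.single_le_sum (f := κ) (fun _ _ => Nat.zero_le _) (Finset.mem_univ _)
      have hh2 : 0 < htt κ := Finset.card_pos.2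
        ⟨⟨n - 1, Nat.sub_lt h3 Nat.one_pos⟩, Finset.mem_filter.2 ⟨Finset.mem_univ _, hl⟩⟩
      simp only at hl hh1 hs
      omega
    · rfl

theorem Phi0_eq (x y z t : ℂ) (hs : Summable fun ω : Σ n, BB n => FF x y z t ω.1 ω.2) :
    Phi0 x y z t = ∑' ω : Σ n, BB n, FF x y z t ω.1 ω.2 := by
  let π : (Σ n, BB n) → ℕ × ℕ × ℕ := fun ω => (∑ i, ω.2.1 i, ω.1, htt ω.2.1)
  rw [← (Equiv.sigmaFiberEquiv π).tsum_eq]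
  have hs' := (Equiv.sigmaFiberEquiv π).summable_iff.2 hs
  rw [Summable.tsum_sigma (by exact hs'), Phi0]
  congr 1
  funext p
  rw [Phi0Term_eq]
  have e1 : ∑' c : {ω // π ω = p}, FF x y z t (Equiv.sigmaFiberEquiv π ⟨p, c⟩).1
      (Equiv.sigmaFiberEquiv π ⟨p, c⟩).2 =
      ∑' c : ({ω | π ω = p} : Set (Σ n, BB n)), (fun ω : Σ n, BB n => FF x y z t ω.1 ω.2) c := rfl
  have e2 := _root_.tsum_subtype {ω | π ω = p} (fun ω : Σ n, BB n => FF x y z t ω.1 ω.2)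
  refine Eq.trans ?_ (e1.trans e2).symm
  have hs2 := hs.indicator {ω | π ω = p}
  rw [hs2.tsum_sigma, tsum_eq_single p.2.1]
  · have hs3 := hs2.comp_injective (sigma_mk_injective (i := p.2.1))
    rw [Summable.tsum_prod (by exact hs3)]
    congr 1
    funext κ
    congr 1
    funext m
    have : ((⟨p.2.1, (κ, m)⟩ : Σ n, BB n) ∈ {ω | π ω = p}) ↔ (∑ i, κ i = p.1 ∧ htt κ = p.2.2) := by
      obtain ⟨k, n, s⟩ := p
      simp [π]
    rw [Set.indicator_apply]
    simp only [this]
  · intro n hn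
    convert tsum_zero with b
    rw [Set.indicator_of_notMem]
    intro h
    apply hn
    have : π ⟨n, b⟩ = p := h
    rw [← this]

theorem hc_aux (x t : ℂ) (hx : ‖x‖ < 1 / 2) (n j : ℕ) :
    (Summable fun k => ‖hc x t n j k‖) ∧ (∑' k, ‖hc x t n j k‖ ≤ 4 * ‖t‖ ^ j) ∧
    ∑' k, hc x t n j k = if j % 2 = (n + 1) % 2 then t ^ j * (2 / (j * (j - x))) else 0 := by
  obtain ⟨h1, h2, h3⟩ := hh_aux x hx j
  by_cases h : j % 2 = (n + 1) % 2 ∧ 0 < j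
  · simp only [hc, if_pos h, if_pos h.1, norm_mul, norm_pow]
    refine ⟨h1.mul_left _, ?_, ?_⟩
    · rw [tsum_mul_left, mul_comm]
      gcongr
    · rw [tsum_mul_left, h3]
  · simp only [hc, if_neg h]
    refine ⟨by simp, ?_, ?_⟩
    · simp only [norm_zero, tsum_zero]
      positivity
    · rw [tsum_zero]
      split_ifs with h4
      · have : j = 0 := by
          by_contra h5
          exact h ⟨h4, Nat.pos_of_ne_zero h5⟩
        simp [this]
      · rfl

theorem FF_aux (x y z t : ℂ) (hx : ‖x‖ < 1 / 2) (hy : ‖y‖ < 1 / 4) (hz : ‖z ^ 2‖ < ‖x * y‖)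
    (ht : ‖t‖ < 1 / 4) (n : ℕ) :
    (Summable fun b => ‖FF x y z t (n + 1) b‖) ∧
    (∑' b, ‖FF x y z t (n + 1) b‖ ≤ 16 * (1 / 2 : ℝ) ^ n) ∧
    ∑' b, FF x y z t (n + 1) b = ∑' j : ℕ, (if j % 2 = (n + 1) % 2 then
      t ^ j * (2 / (j * (j - x))) else 0) * SS x y z n j := by
  have hle : ∀ j, (∑' k, ‖hc x t n j k‖) * ∑' b, ‖VV x y z n j b‖ ≤
      (4 * (1 / 2 : ℝ) ^ n) * (3 / 4) ^ j := by
    intro j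
    have h1 := (hc_aux x t hx n j).2.1
    have h2 := (VV_aux x y z hx hy hz n j).2
    calc _ ≤ (4 * ‖t‖ ^ j) * ((1 / 2 : ℝ) ^ n * 3 ^ j) := by gcongr
      _ ≤ (4 * (1 / 4) ^ j) * ((1 / 2 : ℝ) ^ n * 3 ^ j) := by gcongr
      _ = _ := by rw [div_pow, div_pow 3]; ring
  have hg : HasSum (fun j => (4 * (1 / 2 : ℝ) ^ n) * (3 / 4) ^ j) ((4 * (1 / 2 : ℝ) ^ n) * 4) := by
    have := (hasSum_geometric_of_lt_one (r := (3 / 4 : ℝ)) (by norm_num) (by norm_num)).mul_left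
      (4 * (1 / 2 : ℝ) ^ n)
    norm_num at this ⊢
    exact this
  have hs : Summable fun j => (∑' k, ‖hc x t n j k‖) * ∑' b, ‖VV x y z n j b‖ :=
    Summable.of_nonneg_of_le (fun j => mul_nonneg (tsum_nonneg fun _ => norm_nonneg _)
      (tsum_nonneg fun _ => norm_nonneg _)) hle hg.summable
  obtain ⟨a1, a2, a3⟩ := step_sum (hc x t n) (fun j b => VV x y z n j b)
    (fun j => (hc_aux x t hx n j).1) (fun j => (VV_aux x y z hx hy hz n j).1) hs
  simp only [FF_succ]
  refine ⟨(ee n).summable_iff.2 a1, ?_, ?_⟩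
  · rw [(ee n).tsum_eq (fun p => ‖hc x t n p.1 p.2.1 * VV x y z n p.1 p.2.2‖), a2]
    refine (hs.tsum_le_tsum hle hg.summable).trans ?_
    rw [hg.tsum_eq]
    linarith
  · rw [(ee n).tsum_eq (fun p => hc x t n p.1 p.2.1 * VV x y z n p.1 p.2.2), a3]
    simp only [(hc_aux x t hx n _).2.2, SS]

theorem FF_zero (x y z t : ℂ) (b : BB 0) : FF x y z t 0 b = 0 := by
  simp [FF]

theorem FF_summable (x y z t : ℂ) (hx : ‖x‖ < 1 / 2) (hy : ‖y‖ < 1 / 4) (hz : ‖z ^ 2‖ < ‖x * y‖)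
    (ht : ‖t‖ < 1 / 4) : Summable fun ω : Σ n, BB n => ‖FF x y z t ω.1 ω.2‖ := by
  rw [summable_sigma_of_nonneg (fun _ => norm_nonneg _)]
  constructor
  · intro n
    rcases n with _ | n
    · simp [FF_zero]
    · exact (FF_aux x y z t hx hy hz ht n).1
  · rw [← summable_nat_add_iff 1]
    refine Summable.of_nonneg_of_le (fun _ => tsum_nonneg fun _ => norm_nonneg _)
      (fun n => (FF_aux x y z t hx hy hz ht n).2.1) ?_
    exact summable_geometric_two.mul_left _

def RR (x y z : ℂ) (j : ℕ) : ℂ :=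
  ∑' n : ℕ, if j % 2 = (n + 1) % 2 then SS x y z n j else 0

def cc (x y z : ℂ) (j : ℕ) : ℂ := 2 / (j * (j - x)) * RR x y z j

theorem SS_norm (x y z : ℂ) (hx : ‖x‖ < 1 / 2) (hy : ‖y‖ < 1 / 4) (hz : ‖z ^ 2‖ < ‖x * y‖)
    (n j : ℕ) : ‖SS x y z n j‖ ≤ (1 / 2 : ℝ) ^ n * 3 ^ j :=
  (norm_tsum_le_tsum_norm (VV_aux x y z hx hy hz n j).1).trans (VV_aux x y z hx hy hz n j).2

theorem RR_summable (x y z : ℂ) (hx : ‖x‖ < 1 / 2) (hy : ‖y‖ < 1 / 4) (hz : ‖z ^ 2‖ < ‖x * y‖)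
    (j : ℕ) : Summable fun n : ℕ => if j % 2 = (n + 1) % 2 then SS x y z n j else 0 := by
  apply Summable.of_norm
  refine Summable.of_nonneg_of_le (fun _ => norm_nonneg _) (fun n => ?_)
    (summable_geometric_two.mul_right ((3 : ℝ) ^ j))
  split_ifs
  · exact SS_norm x y z hx hy hz n j
  · rw [norm_zero]; positivity

theorem Phi0_hasSum (x y z t : ℂ) (hx : ‖x‖ < 1 / 2) (hy : ‖y‖ < 1 / 4) (hz : ‖z ^ 2‖ < ‖x * y‖)
    (ht : ‖t‖ < 1 / 4) : HasSum (fun j => cc x y z j * t ^ j) (Phi0 x y z t) := by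
  have hs := (FF_summable x y z t hx hy hz ht).of_norm
  have hA : Summable (fun q : ℕ × ℕ => (if q.2 % 2 = (q.1 + 1) % 2 then
      t ^ q.2 * (2 / (q.2 * (q.2 - x))) else 0) * SS x y z q.1 q.2) := by
    apply Summable.of_norm
    have h1 : Summable fun j : ℕ => (4 : ℝ) * (3 / 4) ^ j :=
      (summable_geometric_of_lt_one (by norm_num) (by norm_num)).mul_left _
    refine Summable.of_nonneg_of_le (fun _ => norm_nonneg _) (fun q => ?_)
      (summable_geometric_two.mul_of_nonneg h1 (fun _ => by positivity) (fun _ => by positivity))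
    obtain ⟨n, j⟩ := q
    have h2 : ‖(if j % 2 = (n + 1) % 2 then t ^ j * (2 / ((j : ℂ) * (j - x))) else 0)‖
        ≤ 4 * ‖t‖ ^ j := by
      rw [← (hc_aux x t hx n j).2.2]
      exact (norm_tsum_le_tsum_norm (hc_aux x t hx n j).1).trans (hc_aux x t hx n j).2.1
    have h3 := SS_norm x y z hx hy hz n j
    simp only
    rw [norm_mul]
    calc _ ≤ (4 * ‖t‖ ^ j) * ((1 / 2 : ℝ) ^ n * 3 ^ j) := by gcongr
      _ ≤ (4 * (1 / 4) ^ j) * ((1 / 2 : ℝ) ^ n * 3 ^ j) := by gcongr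
      _ = _ := by rw [div_pow, div_pow 3]; ring
  have e : Phi0 x y z t = ∑' n : ℕ, ∑' j : ℕ, (if j % 2 = (n + 1) % 2 then
      t ^ j * (2 / (j * (j - x))) else 0) * SS x y z n j := by
    rw [Phi0_eq x y z t hs, hs.tsum_sigma]
    have hs1 : Summable fun n => ∑' b : BB n, FF x y z t n b := hs.sigma
    rw [hs1.tsum_eq_zero_add]
    simp only [FF_zero, tsum_zero, zero_add, (FF_aux x y z t hx hy hz ht _).2.2]
  have hcol : ∀ j : ℕ, ∑' n : ℕ, (if j % 2 = (n + 1) % 2 then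
      t ^ j * (2 / ((j : ℂ) * (j - x))) else 0) * SS x y z n j = cc x y z j * t ^ j := by
    intro j
    rw [cc, RR, mul_right_comm, ← tsum_mul_left]
    congr 1
    funext n
    split_ifs
    · ring
    · simp
  have hA' := hA.prod_symm
  have h2 := hA'.prod
  have h3 := h2.hasSum
  rw [e, Summable.tsum_comm (by exact hA')]
  simp only [Prod.swap_prod_mk, hcol] at h3 ⊢
  exact h3

theorem RR_zero (x y z : ℂ) (hx : ‖x‖ < 1 / 2) (hy : ‖y‖ < 1 / 4) (hz : ‖z ^ 2‖ < ‖x * y‖) :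
    RR x y z 0 = 0 := by
  rw [RR]
  convert tsum_zero with n
  rcases n with _ | n
  · simp
  · simp [SS_succ x y z hx hy hz]

theorem RR_one (x y z : ℂ) (hx : ‖x‖ < 1 / 2) (hy : ‖y‖ < 1 / 4) (hz : ‖z ^ 2‖ < ‖x * y‖) :
    RR x y z 1 = 1 := by
  rw [RR, tsum_eq_single 0]
  · simp [SS_zero]
  · intro n hn
    obtain ⟨n, rfl⟩ := Nat.exists_eq_succ_of_ne_zero hn
    simp [SS_succ x y z hx hy hz, ww]

theorem RR_rec (x y z : ℂ) (hx : ‖x‖ < 1 / 2) (hy : ‖y‖ < 1 / 4) (hz : ‖z ^ 2‖ < ‖x * y‖) (j : ℕ) :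
    RR x y z (j + 2) - RR x y z j = ww x y z (j + 1) * RR x y z (j + 1) := by
  have h1 := RR_summable x y z hx hy hz (j + 2)
  have h2 := RR_summable x y z hx hy hz j
  rw [RR, RR, ← h1.tsum_sub h2, (h1.sub h2).tsum_eq_zero_add, RR, ← tsum_mul_left]
  have e0 : ((if (j + 2) % 2 = (0 + 1) % 2 then SS x y z 0 (j + 2) else 0) -
      if j % 2 = (0 + 1) % 2 then SS x y z 0 j else 0) = 0 := by
    simp [SS_zero]
  rw [e0, zero_add]
  congr 1
  funext n
  by_cases h : j % 2 = n % 2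
  · rw [if_pos (by omega), if_pos (by omega), if_pos (by omega), SS_succ x y z hx hy hz,
      SS_succ x y z hx hy hz, Finset.sum_range_succ, Finset.sum_range_succ, if_neg (by omega),
      if_pos (by omega)]
    ring
  · rw [if_neg (by omega), if_neg (by omega), if_neg (by omega)]
    simp

def uu (x y z : ℂ) (j : ℕ) : ℂ := (if j = 0 then 1 else 0) - (x * y - z ^ 2) * cc x y z j

theorem cc_mul (x y z : ℂ) (hx : ‖x‖ < 1 / 2) (hy : ‖y‖ < 1 / 4) (hz : ‖z ^ 2‖ < ‖x * y‖) (j : ℕ) :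
    (j : ℂ) * (j - x) * cc x y z j = 2 * RR x y z j := by
  rcases Nat.eq_zero_or_pos j with rfl | hj
  · simp [RR_zero x y z hx hy hz]
  · have h1 := sub_ne x hx j hj
    have h2 : (j : ℂ) ≠ 0 := by exact_mod_cast hj.ne'
    rw [cc]
    field_simp

theorem uu_rec (x y z : ℂ) (hx : ‖x‖ < 1 / 2) (hy : ‖y‖ < 1 / 4) (hz : ‖z ^ 2‖ < ‖x * y‖) :
    Rec x y z (uu x y z) := by
  have hcc0 : cc x y z 0 = 0 := by simp [cc]
  constructor
  · have h1 := cc_mul x y z hx hy hz 1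
    rw [RR_one x y z hx hy hz] at h1
    simp only [uu, hcc0]
    push_cast at h1
    simp only [one_ne_zero, if_false, if_true]
    linear_combination (-(x * y - z ^ 2)) * h1
  · intro j
    have h0 := cc_mul x y z hx hy hz j
    have h1 := cc_mul x y z hx hy hz (j + 1)
    have h2 := cc_mul x y z hx hy hz (j + 2)
    have h3 := RR_rec x y z hx hy hz j
    have n1 := sub_ne x hx (j + 1) (by omega)
    have n2 : (((j + 1 : ℕ)) : ℂ) ≠ 0 := by exact_mod_cast Nat.succ_ne_zero j
    have h4 : ww x y z (j + 1) * (2 * RR x y z (j + 1)) =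
        2 * (y * (j + 1) - x * y + z ^ 2) * cc x y z (j + 1) := by
      rw [← h1, ww]
      push_cast at n1 n2 ⊢
      field_simp
    have hj : (j : ℂ) * (if j = 0 then 1 else 0) = 0 := by
      split_ifs with h
      · simp [h]
      · simp
    simp only [uu]
    rw [if_neg (by omega : j + 2 ≠ 0), if_neg (by omega : j + 1 ≠ 0)]
    push_cast at h2
    linear_combination (-(x * y - z ^ 2)) * (h2 - h0 + 2 * h3 + h4) - (j - x) * hj

theorem uu_hasSum (x y z t : ℂ) (hx : ‖x‖ < 1 / 2) (hy : ‖y‖ < 1 / 4) (hz : ‖z ^ 2‖ < ‖x * y‖)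
    (ht : ‖t‖ < 1 / 4) :
    HasSum (fun j => uu x y z j * t ^ j) (1 - (x * y - z ^ 2) * Phi0 x y z t) := by
  have h1 := (Phi0_hasSum x y z t hx hy hz ht).mul_left (x * y - z ^ 2)
  have h2 := (hasSum_ite_eq (0 : ℕ) (1 : ℂ)).sub h1
  convert! h2 using 2 with j
  rw [uu]
  split_ifs with h
  · rw [h]; simp [cc]
  · ring

/-- `u(t) = 1 − (xy − z²) Φ₀(t)` is the unique function holomorphic near `t = 0`
with `u(0) = 1` satisfying the homogeneous Heun-type equation
`t(1−t²)u″ + ((1−x)(1−t²) − 2ty)u′ + 2(xy − z²)u = 0`. -/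
theorem u_unique_solution (x y z : ℂ) (hx : ‖x‖ < 1 / 2) (hy : ‖y‖ < 1 / 4)
    (hx0 : x ≠ 0) (hy0 : y ≠ 0) (hz : ‖z ^ 2‖ < ‖x * y‖) :
    ∃ r > (0 : ℝ),
      DifferentiableOn ℂ (fun t => 1 - (x * y - z ^ 2) * Phi0 x y z t) (ball (0 : ℂ) r) ∧
      1 - (x * y - z ^ 2) * Phi0 x y z 0 = 1 ∧
      (∀ t ∈ ball (0 : ℂ) r,
        t * (1 - t ^ 2) * deriv (deriv (fun t => 1 - (x * y - z ^ 2) * Phi0 x y z t)) t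
          + ((1 - x) * (1 - t ^ 2) - 2 * t * y)
            * deriv (fun t => 1 - (x * y - z ^ 2) * Phi0 x y z t) t
          + 2 * (x * y - z ^ 2) * (1 - (x * y - z ^ 2) * Phi0 x y z t) = 0) ∧
      ∀ (w : ℂ → ℂ) (ρ : ℝ), 0 < ρ → DifferentiableOn ℂ w (ball (0 : ℂ) ρ) → w 0 = 1 →
        (∀ t ∈ ball (0 : ℂ) ρ,
          t * (1 - t ^ 2) * deriv (deriv w) t
            + ((1 - x) * (1 - t ^ 2) - 2 * t * y) * deriv w t
            + 2 * (x * y - z ^ 2) * w t = 0) →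
        w =ᶠ[nhds (0 : ℂ)] fun t => 1 - (x * y - z ^ 2) * Phi0 x y z t := by
  have h14 : (0 : ℝ) < 1 / 4 := by norm_num
  have hS : ∀ t ∈ ball (0 : ℂ) (1 / 4), HasSum (fun j => uu x y z j * t ^ j)
      (1 - (x * y - z ^ 2) * Phi0 x y z t) := fun t ht =>
    uu_hasSum x y z t hx hy hz (by simpa using ht)
  have hfps := ps_fps (uu x y z) (fun t => 1 - (x * y - z ^ 2) * Phi0 x y z t) (1 / 4) h14 hS
  have hd : DifferentiableOn ℂ (fun t => 1 - (x * y - z ^ 2) * Phi0 x y z t)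
      (ball (0 : ℂ) (1 / 4 / 2)) := by
    have := hfps.differentiableOn
    rwa [Metric.eball_ofReal] at this
  have h18 : (0 : ℝ) < 1 / 4 / 2 := by norm_num
  have hsub : ball (0 : ℂ) (1 / 4 / 2) ⊆ ball (0 : ℂ) (1 / 4) := ball_subset_ball (by norm_num)
  have htc : tc (fun t => 1 - (x * y - z ^ 2) * Phi0 x y z t) = uu x y z := by
    funext j
    exact tc_unique h18 hd (uu x y z) (fun t ht => hS t (hsub ht)) j
  have hrec := uu_rec x y z hx hy hz
  have hu0 : uu x y z 0 = 1 := by simp [uu, cc]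
  refine ⟨1 / 4 / 2, h18, hd, ?_, ?_, ?_⟩
  · have h := congrFun htc 0
    rw [hu0] at h
    simpa [tc] using h
  · exact (ode_iff_rec x y z h18 hd).2 (by rw [htc]; exact hrec)
  · intro w ρ hρ hw hw0 hode
    have hwr := (ode_iff_rec x y z hρ hw).1 hode
    have heq := rec_unique x y z hx _ _ hwr hrec (by simp [tc, hw0, hu0])
    have hm : (0 : ℝ) < min ρ (1 / 4) := lt_min hρ h14
    filter_upwards [ball_mem_nhds (0 : ℂ) hm] with t ht
    have a1 := tc_hasSum hw (ball_subset_ball (min_le_left _ _) ht)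
    have a2 := hS t (ball_subset_ball (min_le_right _ _) ht)
    simp only [heq] at a1
    exact a1.unique a2

end
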